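/- Let x be a nonnegative integer and n an odd positive integer. Then S(x,n)² = 2^{2x} · det_{0≤i,j≤n−2}( (2x+i+j+1)! · (3x+3i+4) · (3x+3j+4) · (3j−3i) / ((x+2i−j+2)! · (x+2j−i+2)!) ), where the determinant is taken over the rationals, 1/k! is interpreted as 0 whenever k is a negative integer, and for n = 1 the determinant is the empty (0×0) determinant, equal to 1. (Theorem 1, item (3), odd case) -/

import Mathlib

open Finset

open scoped Classical

/-- The binomial coefficient `C(N,r)` for integers, equal to `0` for `r < 0` or `r > N`. -/
def ibinom (N r : ℤ) : ℤ := if 0 ≤ r ∧ r ≤ N then ((N.toNat).choose r.toNat : ℤ) else 0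

/-- `S(x,n)`: the sum of all `n×n` minors of the `n×(2n+x-1)` matrix with entries
`C(x+i, j-i)`, i.e. the sum over strictly increasing `λ : Fin n → Fin (2n+x-1)` of
`det (C(x+i, λ_j - i))`. -/
noncomputable def Sminor (x n : ℕ) : ℤ :=
  ∑ f : Fin n → Fin (2 * n + x - 1),
    if StrictMono f then
      Matrix.det (Matrix.of fun i j : Fin n =>
        ibinom ((x : ℤ) + (i : ℕ)) ((((f j : ℕ) : ℤ)) - ((i : ℕ) : ℤ)))
    else 0

/-- `rfacInv k = 1/k!` for `k ≥ 0`, and `0` for negative `k`. -/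
noncomputable def rfacInv (k : ℤ) : ℚ := if 0 ≤ k then (Nat.factorial k.toNat : ℚ)⁻¹ else 0

/-- The sign of `l - k`. -/
def orderSign {m : ℕ} (k l : Fin m) : ℤ := if k < l then 1 else if l < k then -1 else 0

theorem orderSign_swap {m : ℕ} (k l : Fin m) : orderSign k l = -orderSign l k := by
  unfold orderSign
  rcases lt_trichotomy k l with h | h | h
  · simp [h, h.not_gt]
  · simp [h]
  · simp [h, h.not_gt]

theorem sum_neg_one_pow_mul_ite_lt (N p : ℕ) (hp : p ≤ N) :
    ∑ i : Fin N, (-1 : ℤ) ^ (i : ℕ) * (if (i : ℕ) < p then -1 else 1) =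
      (-1) ^ p - if Even N then 1 else 0 := by
  induction N generalizing p with
  | zero =>
    obtain rfl : p = 0 := by omega
    simp
  | succ N ih =>
    rw [Fin.sum_univ_castSucc]
    simp only [Fin.val_castSucc, Fin.val_last]
    rcases Nat.lt_or_ge N p with h | h
    · obtain rfl : p = N + 1 := by omega
      have h1 := ih N le_rfl
      have h2 : ∀ i : Fin N, ((i : ℕ) < N + 1) ↔ ((i : ℕ) < N) := fun i => by omega
      simp only [h2, h1, Nat.even_add_one]
      rcases Nat.even_or_odd N with h3 | h3
      · simp [h3, pow_succ]
      · simp [Nat.not_even_iff_odd.2 h3, h3.neg_one_pow, pow_succ]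
    · rw [ih p h, if_neg (not_lt.2 h)]
      simp only [Nat.even_add_one]
      rcases Nat.even_or_odd N with h3 | h3
      · simp [h3]
      · simp [Nat.not_even_iff_odd.2 h3, h3.neg_one_pow, sub_eq_add_neg, add_comm]

theorem sum_neg_one_pow (N : ℕ) :
    ∑ i : Fin N, (-1 : ℤ) ^ (i : ℕ) = if Even N then 0 else 1 := by
  have h := sum_neg_one_pow_mul_ite_lt N 0 (Nat.zero_le _)
  simp only [Nat.not_lt_zero, if_false, mul_one, pow_zero] at h
  rw [h]
  split_ifs <;> simp

theorem sum_neg_one_pow_mul_orderSign_self {m N : ℕ} {g : Fin N → Fin m} (hg : StrictMono g)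
    (a : Fin N) :
    ∑ i : Fin N, (-1 : ℤ) ^ (i : ℕ) * orderSign (g a) (g i) = -if Even N then 1 else 0 := by
  have h1 := sum_neg_one_pow_mul_ite_lt N a a.2.le
  have h2 := sum_neg_one_pow_mul_ite_lt N (a + 1) a.2
  have h3 : ∀ i : Fin N, 2 * ((-1 : ℤ) ^ (i : ℕ) * orderSign (g a) (g i)) =
      (-1 : ℤ) ^ (i : ℕ) * (if (i : ℕ) < a then -1 else 1) +
      (-1 : ℤ) ^ (i : ℕ) * (if (i : ℕ) < a + 1 then -1 else 1) := by
    intro i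
    simp only [orderSign, hg.lt_iff_lt, Fin.lt_def]
    split_ifs <;> omega
  have h4 := Finset.sum_congr rfl fun i (_ : i ∈ Finset.univ) => h3 i
  rw [← Finset.mul_sum, Finset.sum_add_distrib, h1, h2, pow_succ] at h4
  linarith

theorem StrictMono.exists_lt_iff {m N : ℕ} {g : Fin N → Fin m} (hg : StrictMono g) (k : Fin m) :
    ∃ p : Fin (N + 1), ∀ i : Fin N, g i < k ↔ (i : ℕ) < p := by
  refine ⟨⟨(Finset.univ.filter fun i => g i < k).card, ?_⟩, fun i => ⟨fun h => ?_, fun h => ?_⟩⟩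
  · exact Nat.lt_succ_of_le ((Finset.card_le_univ _).trans (by simp))
  · have : Finset.Iic i ⊆ Finset.univ.filter fun i => g i < k := fun j hj => by
      simpa using (hg.monotone (Finset.mem_Iic.1 hj)).trans_lt h
    have := Finset.card_le_card this
    rw [Fin.card_Iic] at this
    exact this
  · by_contra h'
    have : (Finset.univ.filter fun i => g i < k) ⊆ Finset.Iio i := fun j hj => by
      simp only [Finset.mem_filter, Finset.mem_univ, true_and] at hj
      rw [Finset.mem_Iio]
      by_contra h2
      exact h' ((hg.monotone (not_lt.1 h2)).trans_lt hj)
    have := Finset.card_le_card this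
    rw [Fin.card_Iio] at this
    exact absurd h (not_lt.2 this)

theorem StrictMono.insertNth {m N : ℕ} {g : Fin N → Fin m} (hg : StrictMono g) {k : Fin m}
    {p : Fin (N + 1)} (hp : ∀ i : Fin N, g i < k ↔ (i : ℕ) < p) (hk : ∀ i, g i ≠ k) :
    StrictMono (p.insertNth (α := fun _ => Fin m) k g) := by
  refine (Fin.strictMono_insertNth_iff p k g).2 ⟨hg, fun i hi => (hp i).2 hi, fun i hi => ?_⟩
  exact lt_of_le_of_ne (not_lt.1 fun h => not_lt.2 hi ((hp i).1 h)) (hk i).symm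

theorem sum_neg_one_pow_mul_orderSign_of_ne {m N : ℕ} {g : Fin N → Fin m} {k : Fin m}
    {p : Fin (N + 1)} (hp : ∀ i : Fin N, g i < k ↔ (i : ℕ) < p) (hk : ∀ i, g i ≠ k) :
    ∑ i : Fin N, (-1 : ℤ) ^ (i : ℕ) * orderSign k (g i) =
      (-1) ^ (p : ℕ) - if Even N then 1 else 0 := by
  rw [← sum_neg_one_pow_mul_ite_lt N p (Nat.lt_succ_iff.1 p.2)]
  refine Finset.sum_congr rfl fun i _ => ?_
  simp only [← hp, orderSign]
  rcases lt_or_gt_of_ne (hk i) with h | h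
  · simp [h, h.not_gt]
  · simp [h, h.not_gt]

section MinorSum

variable {R : Type} [CommRing R]

/-- The sum of all maximal minors of the matrix with the given rows, as an alternating map. -/
noncomputable def minorSum (R : Type) [CommRing R] (n m : ℕ) : (Fin m → R) [⋀^Fin n]→ₗ[R] R :=
  ∑ f : Fin n → Fin m with StrictMono f,
    Matrix.detRowAlternating.compLinearMap (LinearMap.funLeft R R f)

theorem minorSum_apply {n m : ℕ} (v : Fin n → Fin m → R) :
    minorSum R n m v =
      ∑ f : Fin n → Fin m with StrictMono f, Matrix.det (Matrix.of fun i j => v i (f j)) := by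
  let ev : (Fin m → R) [⋀^Fin n]→ₗ[R] R →+ R := ⟨⟨fun φ => φ v, rfl⟩, fun _ _ => rfl⟩
  exact map_sum ev _ _

theorem minorSum_single {n m : ℕ} {g : Fin n → Fin m} (hg : StrictMono g) :
    minorSum R n m (fun i => Pi.single (g i) 1) = 1 := by
  rw [minorSum_apply, Finset.sum_eq_single g]
  · rw [← Matrix.det_one (n := Fin n)]
    congr 1
    ext i j
    simp [Pi.single_apply, Matrix.one_apply, hg.injective.eq_iff, eq_comm]
  · intro f hf hfg
    simp only [Finset.mem_filter, Finset.mem_univ, true_and] at hf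
    obtain ⟨i, hi⟩ : ∃ i, g i ∉ Set.range f := by
      by_contra! h
      refine hfg (?_ : f = g)
      refine (StrictMono.range_inj hf hg).1 ?_
      symm
      refine Set.eq_of_subset_of_card_le (Set.range_subset_iff.2 h) ?_
      rw [Set.card_range_of_injective hf.injective, Set.card_range_of_injective hg.injective]
    refine Matrix.det_eq_zero_of_row_eq_zero i fun j => ?_
    rw [Matrix.of_apply, Pi.single_apply, if_neg]
    exact fun h => hi ⟨j, h⟩
  · intro h
    simp [hg] at h

theorem AlternatingMap.ext_of_strictMono {n m : ℕ} {φ ψ : (Fin m → R) [⋀^Fin n]→ₗ[R] R}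
    (h : ∀ g : Fin n → Fin m, StrictMono g →
      φ (fun i => Pi.single (g i) 1) = ψ (fun i => Pi.single (g i) 1)) : φ = ψ := by
  refine Module.Basis.ext_alternating (Pi.basisFun R (Fin m)) fun g hg => ?_
  simp only [Pi.basisFun_apply]
  have hs : StrictMono (g ∘ Tuple.sort g) :=
    (Tuple.monotone_sort g).strictMono_of_injective (hg.comp (Tuple.sort g).injective)
  have h1 := h _ hs
  have h2 : (fun i => Pi.single ((g ∘ Tuple.sort g) i) (1 : R) : Fin n → Fin m → R) =
      (fun i => Pi.single (g i) 1) ∘ Tuple.sort g := rfl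
  rw [h2, AlternatingMap.map_perm, AlternatingMap.map_perm] at h1
  exact smul_left_cancel _ h1

/-- The linear form summing all coordinates. -/
def coordSum (R : Type) [CommRing R] (m : ℕ) : (Fin m → R) →ₗ[R] R :=
  ∑ k, LinearMap.proj k

theorem coordSum_apply {m : ℕ} (y : Fin m → R) : coordSum R m y = ∑ k, y k := by
  simp [coordSum]

/-- The skew bilinear form with values `orderSign k l` on the standard basis. -/
noncomputable def signForm (R : Type) [CommRing R] (m : ℕ) :
    (Fin m → R) →ₗ[R] (Fin m → R) →ₗ[R] R :=
  Matrix.toLinearMap₂' R (Matrix.of fun k l => (orderSign k l : R))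

theorem signForm_apply {m : ℕ} (y z : Fin m → R) :
    signForm R m y z = ∑ k, ∑ l, y k * z l * orderSign k l := by
  rw [signForm, Matrix.toLinearMap₂'_apply]
  simp [mul_assoc]

theorem signForm_single {m : ℕ} (k l : Fin m) :
    signForm R m (Pi.single k 1) (Pi.single l 1) = orderSign k l := by
  simp [signForm_apply, Pi.single_apply]

theorem signForm_swap {m : ℕ} (y z : Fin m → R) : signForm R m y z = -signForm R m z y := by
  rw [signForm_apply, signForm_apply, Finset.sum_comm, ← Finset.sum_neg_distrib]
  refine Finset.sum_congr rfl fun k _ => ?_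
  rw [← Finset.sum_neg_distrib]
  refine Finset.sum_congr rfl fun l _ => ?_
  rw [orderSign_swap]
  push_cast
  ring

theorem sum_coordSum_mul_minorSum {n m : ℕ} (v : Fin (n + 1) → Fin m → R) :
    ∑ i : Fin (n + 1), (-1) ^ (i : ℕ) * (coordSum R m (v i) * minorSum R n m (i.removeNth v)) =
      (if Even (n + 1) then 0 else 1) * minorSum R (n + 1) m v := by
  have h : AlternatingMap.alternatizeUncurryFin ((coordSum R m).smulRight (minorSum R n m)) =
      (if Even (n + 1) then (0 : R) else 1) • minorSum R (n + 1) m := by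
    refine AlternatingMap.ext_of_strictMono fun g hg => ?_
    rw [AlternatingMap.alternatizeUncurryFin_apply, AlternatingMap.smul_apply, minorSum_single hg]
    have h2 : ∀ i : Fin (n + 1), minorSum R n m
        (i.removeNth (fun i => Pi.single (g i) 1 : Fin (n + 1) → Fin m → R)) = 1 := fun i =>
      minorSum_single (hg.comp (Fin.strictMono_succAbove i))
    simp only [LinearMap.smulRight_apply, AlternatingMap.smul_apply, h2, coordSum_apply]
    have h3 := congrArg (Int.cast (R := R)) (sum_neg_one_pow (n + 1))
    push_cast at h3
    simpa using h3
  have h1 := congrArg (fun φ => φ v) h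
  revert h1
  generalize (if Even (n + 1) then (0 : R) else 1) = e
  intro h1
  simpa [AlternatingMap.alternatizeUncurryFin_apply] using h1

theorem sum_signForm_single_mul_minorSum {n m : ℕ} {g : Fin (n + 1) → Fin m} (hg : StrictMono g)
    (k : Fin m) :
    ∑ i : Fin (n + 1), (-1) ^ (i : ℕ) * (orderSign k (g i) : R) =
      minorSum R (n + 2) m (Matrix.vecCons (Pi.single k 1) fun i => Pi.single (g i) 1) -
        if Even (n + 1) then 1 else 0 := by
  by_cases hk : ∃ a, g a = k
  · obtain ⟨a, rfl⟩ := hk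
    rw [AlternatingMap.map_eq_zero_of_eq _ _ (i := 0) (j := a.succ) (by simp)
      (Fin.succ_ne_zero a).symm]
    have h3 := congrArg (Int.cast (R := R)) (sum_neg_one_pow_mul_orderSign_self hg a)
    push_cast at h3
    rw [h3, zero_sub]
  · push Not at hk
    obtain ⟨p, hp⟩ := hg.exists_lt_iff k
    have h3 := congrArg (Int.cast (R := R)) (sum_neg_one_pow_mul_orderSign_of_ne hp hk)
    push_cast at h3
    rw [h3, ← AlternatingMap.neg_one_pow_smul_map_insertNth _ p]
    have h4 : (p.insertNth (Pi.single k 1) fun i => Pi.single (g i) 1 :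
        Fin (n + 2) → Fin m → R) =
        fun i => Pi.single (p.insertNth (α := fun _ => Fin m) k g i) 1 := by
      ext i : 1
      induction i using p.succAboveCases <;> simp
    rw [h4, minorSum_single (hg.insertNth hp hk)]
    simp

theorem sum_signForm_mul_minorSum {n m : ℕ} (y : Fin m → R) (v : Fin (n + 1) → Fin m → R) :
    ∑ i : Fin (n + 1), (-1) ^ (i : ℕ) * (signForm R m y (v i) * minorSum R n m (i.removeNth v)) =
      minorSum R (n + 2) m (Matrix.vecCons y v) -
        (if Even (n + 1) then 1 else 0) * (coordSum R m y * minorSum R (n + 1) m v) := by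
  have h : AlternatingMap.alternatizeUncurryFin ((signForm R m y).smulRight (minorSum R n m)) =
      (minorSum R (n + 2) m).curryLeft y -
        (if Even (n + 1) then (1 : R) else 0) • coordSum R m y • minorSum R (n + 1) m := by
    refine AlternatingMap.ext_of_strictMono fun g hg => ?_
    have h2 : ∀ i : Fin (n + 1), minorSum R n m
        (i.removeNth (fun i => Pi.single (g i) 1 : Fin (n + 1) → Fin m → R)) = 1 := fun i =>
      minorSum_single (hg.comp (Fin.strictMono_succAbove i))
    simp only [AlternatingMap.alternatizeUncurryFin_apply, AlternatingMap.sub_apply,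
      AlternatingMap.smul_apply, minorSum_single hg, LinearMap.smulRight_apply, h2]
    let φ : (Fin m → R) →ₗ[R] R := IsLinearMap.mk'
      (fun y => minorSum R (n + 2) m (Matrix.vecCons y fun i => Pi.single (g i) 1))
      ⟨AlternatingMap.map_vecCons_add _ _, fun c y => AlternatingMap.map_vecCons_smul _ _ c y⟩
    have h5 := sum_signForm_single_mul_minorSum (R := R) hg
    revert h5
    generalize (if Even (n + 1) then (1 : R) else 0) = e
    intro h5
    have H : ∑ i : Fin (n + 1), (-1 : R) ^ (i : ℕ) • (signForm R m).flip (Pi.single (g i) 1) =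
        φ - e • coordSum R m := by
      refine LinearMap.pi_ext' fun k => LinearMap.ext_ring ?_
      simpa [φ, signForm_single, coordSum_apply] using h5 k
    have H' := LinearMap.congr_fun H y
    simpa [φ] using H'
  have h1 := congrArg (fun φ => φ v) h
  revert h1
  generalize (if Even (n + 1) then (1 : R) else 0) = e
  intro h1
  simpa [AlternatingMap.alternatizeUncurryFin_apply] using h1

end MinorSum

section Bordered

variable {R : Type} {n : ℕ}

/-- The matrix `X` with a new first row `(t, w)` and a new first column `(t, u)`. -/
def bordered (t : R) (w u : Fin n → R) (X : Matrix (Fin n) (Fin n) R) :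
    Matrix (Fin (n + 1)) (Fin (n + 1)) R :=
  Matrix.of (Fin.cons (Fin.cons t w) fun i => Fin.cons (u i) (X i))

@[simp]
theorem bordered_zero_zero (t : R) (w u : Fin n → R) (X : Matrix (Fin n) (Fin n) R) :
    bordered t w u X 0 0 = t := rfl

@[simp]
theorem bordered_zero_succ (t : R) (w u : Fin n → R) (X : Matrix (Fin n) (Fin n) R) (j : Fin n) :
    bordered t w u X 0 j.succ = w j := rfl

@[simp]
theorem bordered_succ_zero (t : R) (w u : Fin n → R) (X : Matrix (Fin n) (Fin n) R) (i : Fin n) :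
    bordered t w u X i.succ 0 = u i := rfl

@[simp]
theorem bordered_succ_succ (t : R) (w u : Fin n → R) (X : Matrix (Fin n) (Fin n) R)
    (i j : Fin n) : bordered t w u X i.succ j.succ = X i j := rfl

theorem eq_bordered (A : Matrix (Fin (n + 1)) (Fin (n + 1)) R) :
    A = bordered (A 0 0) (fun j => A 0 j.succ) (fun i => A i.succ 0)
      (A.submatrix Fin.succ Fin.succ) := by
  ext i j
  induction i using Fin.cases <;> induction j using Fin.cases <;> simp

variable [CommRing R]

theorem det_bordered (t : R) (w u : Fin n → R) (X : Matrix (Fin n) (Fin n) R) :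
    (bordered t w u X).det = (bordered 0 w u X).det + t * X.det := by
  have h : ∀ t : R, ∀ i : Fin (n + 1), (bordered t w u X).submatrix i.succAbove Fin.succ =
      (bordered 0 w u X).submatrix i.succAbove Fin.succ := by
    intro t i
    ext a b
    simp only [Matrix.submatrix_apply]
    generalize i.succAbove a = a
    induction a using Fin.cases <;> simp
  have h0 : (bordered 0 w u X).submatrix (Fin.succAbove 0) Fin.succ = X := by
    ext a b
    simp
  rw [Matrix.det_succ_column_zero, Matrix.det_succ_column_zero (bordered 0 w u X),
    Fin.sum_univ_succ, Fin.sum_univ_succ]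
  simp only [h t, h0, bordered_zero_zero, bordered_succ_zero]
  simp
  ring

theorem det_bordered_zero_column (t : R) (w : Fin n → R) (X : Matrix (Fin n) (Fin n) R) :
    (bordered t w 0 X).det = t * X.det := by
  rw [det_bordered, Matrix.det_eq_zero_of_column_eq_zero 0, zero_add]
  intro i
  induction i using Fin.cases <;> simp

theorem det_bordered_add_row (t : R) (w u c : Fin n → R) (X : Matrix (Fin n) (Fin n) R) :
    (bordered t w (u + t • c) (X + Matrix.vecMulVec c w)).det = (bordered t w u X).det := by
  refine Matrix.det_eq_of_forall_row_eq_smul_add_const (Fin.cons 0 c) 0 rfl fun i j => ?_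
  induction i using Fin.cases <;> induction j using Fin.cases <;>
    simp [Matrix.vecMulVec_apply, mul_comm]

theorem det_bordered_smul (a t : R) (w u : Fin n → R) (X : Matrix (Fin n) (Fin n) R) :
    (bordered (t * a ^ 2) (a • w) (a • u) X).det = a ^ 2 * (bordered t w u X).det := by
  have h1 := Matrix.det_mul_column (Fin.cons a 1) (bordered t w u X)
  have h2 := Matrix.det_mul_row (Fin.cons a 1)
    (Matrix.of fun i j => (Fin.cons a 1 : Fin (n + 1) → R) i * bordered t w u X i j)
  rw [h1] at h2
  simp only [Fin.prod_univ_succ, Fin.cons_zero, Fin.cons_succ, Pi.one_apply, Finset.prod_const_one,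
    mul_one] at h2
  rw [pow_two, mul_assoc, ← h2]
  congr 1
  ext i j
  induction i using Fin.cases <;> induction j using Fin.cases <;> simp
  ring

theorem Matrix.det_eq_zero_of_odd_skew [IsDomain R] [CharZero R] (hn : Odd n)
    {X : Matrix (Fin n) (Fin n) R} (hX : X.transpose = -X) : X.det = 0 := by
  have h := Matrix.det_transpose X
  rw [hX, Matrix.det_neg, Fintype.card_fin, hn.neg_one_pow] at h
  have h2 : 2 * X.det = 0 := by linear_combination -h
  exact (mul_eq_zero.1 h2).resolve_left two_ne_zero

theorem bordered_skew (s : Fin n → R) {X : Matrix (Fin n) (Fin n) R} (hX : X.transpose = -X) :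
    (bordered 0 s (-s) X).transpose = -bordered 0 s (-s) X := by
  ext i j
  induction i using Fin.cases <;> induction j using Fin.cases <;> simp
  simpa using congrFun (congrFun hX _) _

theorem det_add_vecMulVec (s : Fin n → R) (X : Matrix (Fin n) (Fin n) R) :
    (X + Matrix.vecMulVec s s).det = (bordered 0 s (-s) X).det + X.det := by
  have h := det_bordered_add_row 1 s (-s) s X
  rw [one_smul, neg_add_cancel, det_bordered_zero_column, one_mul] at h
  rw [h, det_bordered, one_mul]

end Bordered

section Gram

variable {R : Type} [CommRing R] {n m : ℕ}

/-- The Gram matrix of the sign form. -/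
noncomputable def signGram (v : Fin n → Fin m → R) : Matrix (Fin n) (Fin n) R :=
  Matrix.of fun i j => signForm R m (v i) (v j)

theorem signGram_transpose (v : Fin n → Fin m → R) : (signGram v).transpose = -signGram v := by
  ext i j
  exact signForm_swap _ _

/-- The Gram matrix of the form with values `1 + orderSign k l` on the standard basis. -/
noncomputable def upperGram (v : Fin n → Fin m → R) : Matrix (Fin n) (Fin n) R :=
  signGram v + Matrix.vecMulVec (fun i => coordSum R m (v i)) (fun i => coordSum R m (v i))

theorem upperGram_apply (v : Fin n → Fin m → R) (i j : Fin n) :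
    upperGram v i j = signForm R m (v i) (v j) + coordSum R m (v i) * coordSum R m (v j) := rfl

theorem sum_minorSum_mul_upperGram (v : Fin (n + 1) → Fin m → R) (j : Fin (n + 1)) :
    ∑ i : Fin (n + 1), (-1) ^ (i : ℕ) * minorSum R n m (i.removeNth v) * upperGram v i j =
      coordSum R m (v j) * minorSum R (n + 1) m v := by
  have h1 := sum_coordSum_mul_minorSum v
  have h2 := sum_signForm_mul_minorSum (v j) v
  rw [AlternatingMap.map_eq_zero_of_eq _ _ (i := 0) (j := j.succ) (by simp)
      (Fin.succ_ne_zero j).symm] at h2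
  have h3 : ∀ i : Fin (n + 1), (-1) ^ (i : ℕ) * minorSum R n m (i.removeNth v) * upperGram v i j =
      coordSum R m (v j) *
        ((-1) ^ (i : ℕ) * (coordSum R m (v i) * minorSum R n m (i.removeNth v))) -
      (-1) ^ (i : ℕ) * (signForm R m (v j) (v i) * minorSum R n m (i.removeNth v)) := by
    intro i
    rw [upperGram_apply, signForm_swap]
    ring
  rw [Finset.sum_congr rfl fun i _ => h3 i, Finset.sum_sub_distrib, ← Finset.mul_sum, h1, h2]
  split_ifs <;> ring

theorem sum_minorSum_mul_upperGram' (v : Fin (n + 1) → Fin m → R) (j : Fin (n + 1)) :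
    ∑ i : Fin (n + 1), (-1) ^ (i : ℕ) * minorSum R n m (i.removeNth v) * upperGram v j i =
      (if Even (n + 1) then -1 else 1) * (coordSum R m (v j) * minorSum R (n + 1) m v) := by
  have h1 := sum_coordSum_mul_minorSum v
  have h2 := sum_signForm_mul_minorSum (v j) v
  rw [AlternatingMap.map_eq_zero_of_eq _ _ (i := 0) (j := j.succ) (by simp)
      (Fin.succ_ne_zero j).symm] at h2
  have h3 : ∀ i : Fin (n + 1), (-1) ^ (i : ℕ) * minorSum R n m (i.removeNth v) * upperGram v j i =
      coordSum R m (v j) *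
        ((-1) ^ (i : ℕ) * (coordSum R m (v i) * minorSum R n m (i.removeNth v))) +
      (-1) ^ (i : ℕ) * (signForm R m (v j) (v i) * minorSum R n m (i.removeNth v)) := by
    intro i
    rw [upperGram_apply]
    ring
  rw [Finset.sum_congr rfl fun i _ => h3 i, Finset.sum_add_distrib, ← Finset.mul_sum, h1, h2]
  split_ifs <;> ring

theorem minorSum_tail_sq_mul_det_upperGram (v : Fin (n + 1) → Fin m → R) :
    minorSum R n m (Fin.tail v) ^ 2 * (upperGram v).det =
      minorSum R (n + 1) m v ^ 2 *
        (bordered (if Even (n + 1) then 0 else 1) (fun i => coordSum R m (Fin.tail v i))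
          ((if Even (n + 1) then -1 else 1 : R) • fun i => coordSum R m (Fin.tail v i))
          (upperGram (Fin.tail v))).det := by
  set l : Fin (n + 1) → R := fun i => (-1) ^ (i : ℕ) * minorSum R n m (i.removeNth v) with hl
  have hl0 : l 0 = minorSum R n m (Fin.tail v) := by simp [hl]
  set A := (upperGram v).updateRow 0 (∑ k, l k • upperGram v k) with hA
  have hA0 : ∀ j, A 0 j = coordSum R m (v j) * minorSum R (n + 1) m v := by
    intro j
    rw [← sum_minorSum_mul_upperGram, hA, Matrix.updateRow_self]
    simp [hl]
  have hAs : ∀ i j, A (Fin.succ i) j = upperGram v i.succ j := by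
    intro i j
    rw [hA, Matrix.updateRow_ne (Fin.succ_ne_zero i)]
  have h1 : (A.updateCol 0 fun k => ∑ i, l i • A k i).det = l 0 ^ 2 * (upperGram v).det := by
    rw [Matrix.det_updateCol_sum, hA, Matrix.det_updateRow_sum]
    simp only [smul_eq_mul]
    ring
  rw [← hl0, ← h1, ← det_bordered_smul]
  congr 1
  ext i j
  induction i using Fin.cases with
  | zero =>
    induction j using Fin.cases with
    | zero =>
      simp only [Matrix.updateCol_self, bordered_zero_zero, hA0, smul_eq_mul, ← mul_assoc]
      rw [← Finset.sum_mul, pow_two, ← mul_assoc, ← sum_coordSum_mul_minorSum]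
      congr 1
      refine Finset.sum_congr rfl fun i _ => ?_
      simp only [hl]
      ring
    | succ j =>
      rw [Matrix.updateCol_ne (Fin.succ_ne_zero j), hA0]
      simp [Fin.tail, mul_comm]
  | succ i =>
    induction j using Fin.cases with
    | zero =>
      simp only [Matrix.updateCol_self, hAs, smul_eq_mul, bordered_succ_zero, Pi.smul_apply]
      rw [sum_minorSum_mul_upperGram']
      simp only [Fin.tail]
      ring
    | succ j =>
      rw [Matrix.updateCol_ne (Fin.succ_ne_zero j), hAs]
      rfl

theorem det_bordered_upperGram [IsDomain R] [CharZero R] (v : Fin n → Fin m → R) :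
    (bordered (if Even (n + 1) then 0 else 1) (fun i => coordSum R m (v i))
      ((if Even (n + 1) then -1 else 1 : R) • fun i => coordSum R m (v i)) (upperGram v)).det =
    (upperGram v).det := by
  set s : Fin n → R := fun i => coordSum R m (v i)
  have h : (upperGram v).det = _ := det_add_vecMulVec s (signGram v)
  have hsk := signGram_transpose v
  rw [h]
  by_cases hn : Even (n + 1)
  · rw [if_pos hn, if_pos hn, neg_one_smul,
      Matrix.det_eq_zero_of_odd_skew (by simpa [Nat.even_add_one] using hn) hsk, add_zero]
    have h2 := det_bordered_add_row 0 s (-s) s (signGram v)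
    rw [zero_smul, add_zero] at h2
    exact h2
  · rw [if_neg hn, if_neg hn, one_smul,
      Matrix.det_eq_zero_of_odd_skew (Nat.not_even_iff_odd.1 hn) (bordered_skew s hsk), zero_add]
    have h2 := det_bordered_add_row 1 s 0 s (signGram v)
    rw [zero_add, one_smul, det_bordered_zero_column, one_mul] at h2
    exact h2

theorem minorSum_map {R' : Type} [CommRing R'] (φ : R →+* R') (v : Fin n → Fin m → R) :
    minorSum R' n m (fun i k => φ (v i k)) = φ (minorSum R n m v) := by
  rw [minorSum_apply, minorSum_apply, map_sum]
  refine Finset.sum_congr rfl fun f _ => ?_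
  rw [RingHom.map_det]
  rfl

theorem upperGram_map {R' : Type} [CommRing R'] (φ : R →+* R') (v : Fin n → Fin m → R) :
    upperGram (fun i k => φ (v i k)) = φ.mapMatrix (upperGram v) := by
  ext i j
  simp [upperGram_apply, signForm_apply, coordSum_apply]

theorem minorSum_tail_X_ne_zero (hnm : n ≤ m) :
    minorSum (MvPolynomial (Fin (n + 1) × Fin m) ℤ) n m
      (Fin.tail fun i k => MvPolynomial.X (i, k)) ≠ 0 := by
  intro h
  let w : Fin (n + 1) → Fin m → ℤ := Fin.cons 0 fun i => Pi.single (Fin.castLE hnm i) 1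
  have h1 := minorSum_map (MvPolynomial.eval fun p : Fin (n + 1) × Fin m => w p.1 p.2)
    (Fin.tail fun i k => MvPolynomial.X (i, k))
  rw [h, map_zero] at h1
  have h2 := minorSum_single (R := ℤ) (Fin.strictMono_castLE hnm)
  simp only [Fin.tail, MvPolynomial.eval_X, w, Fin.cons_succ] at h1
  exact one_ne_zero (h2.symm.trans h1)

/-- The square of the sum of the maximal minors is a determinant. -/
theorem det_upperGram (hnm : n ≤ m) (v : Fin n → Fin m → R) :
    (upperGram v).det = minorSum R n m v ^ 2 := by
  induction n generalizing R with
  | zero =>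
    have h := minorSum_single (R := R) (g := (Fin.elim0 : Fin 0 → Fin m)) fun i => i.elim0
    rw [Matrix.det_fin_zero, Subsingleton.elim v, h, one_pow]
  | succ n ih =>
    let φ : MvPolynomial (Fin (n + 1) × Fin m) ℤ →+* R :=
      MvPolynomial.eval₂Hom (Int.castRingHom R) fun p => v p.1 p.2
    let X : Fin (n + 1) → Fin m → MvPolynomial (Fin (n + 1) × Fin m) ℤ :=
      fun i k => MvPolynomial.X (i, k)
    have hv : v = fun i k => φ (X i k) := by
      ext i k
      simp [φ, X]
    have h := minorSum_tail_sq_mul_det_upperGram X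
    rw [det_bordered_upperGram, ih (Nat.le_of_succ_le hnm), mul_comm] at h
    have h2 := mul_right_cancel₀
      (pow_ne_zero 2 (minorSum_tail_X_ne_zero (Nat.le_of_succ_le hnm))) h
    rw [hv, upperGram_map, ← RingHom.map_det, h2, minorSum_map, map_pow]

end Gram

section Binomial

theorem rfacInv_sub_one (k : ℤ) : rfacInv (k - 1) = k * rfacInv k := by
  unfold rfacInv
  rcases lt_trichotomy k 0 with h | rfl | h
  · rw [if_neg (by omega), if_neg (by omega), mul_zero]
  · simp
  · obtain ⟨m, rfl⟩ : ∃ m : ℕ, k = m + 1 := ⟨(k - 1).toNat, by omega⟩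
    rw [if_pos (by omega), if_pos (by omega), add_sub_cancel_right, Int.toNat_natCast,
      show ((m : ℤ) + 1).toNat = m + 1 by omega, Nat.factorial_succ]
    push_cast
    field_simp

/-- The binomial coefficient `C(m, r)` as a rational number, for integral `r`. -/
noncomputable def qbinom (m : ℕ) (r : ℤ) : ℚ := m.factorial * rfacInv r * rfacInv (m - r)

theorem qbinom_succ (m : ℕ) (r : ℤ) : qbinom (m + 1) r = qbinom m r + qbinom m (r - 1) := by
  unfold qbinom
  have h1 := rfacInv_sub_one r
  have h2 := rfacInv_sub_one (m + 1 - r)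
  rw [show (m : ℤ) + 1 - r - 1 = m - r by ring] at h2
  rw [h1, h2, show (m : ℤ) - (r - 1) = m + 1 - r by ring, Nat.factorial_succ]
  push_cast
  ring

/-- The sign of an integer, as a rational number. -/
def intSign (a : ℤ) : ℚ := if 0 < a then 1 else if a < 0 then -1 else 0

theorem intSign_add_one_sub (a : ℤ) : intSign (a + 1) - intSign a = qbinom 1 (-a) := by
  unfold intSign qbinom rfacInv
  rcases lt_trichotomy a 0 with h | rfl | h
  · rcases eq_or_ne a (-1) with rfl | h2
    · norm_num
    · rw [if_neg (by omega), if_pos (by omega), if_neg (by omega), if_pos h,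
        if_neg (c := 0 ≤ ((1 : ℕ) : ℤ) - -a) (by push_cast; omega)]
      simp
  · norm_num
  · rw [if_pos (by omega), if_pos h, if_neg (c := 0 ≤ -a) (by omega)]
    simp

/-- The `p`-th iterate of the operator `F ↦ F + F (· + 1)`. -/
def binomSum (p : ℕ) (F : ℤ → ℚ) (a : ℤ) : ℚ :=
  ∑ t ∈ Finset.range (p + 1), (p.choose t : ℚ) * F (a + t)

theorem binomSum_zero (F : ℤ → ℚ) : binomSum 0 F = F := by
  ext a
  simp [binomSum]

theorem binomSum_succ (p : ℕ) (F : ℤ → ℚ) (a : ℤ) :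
    binomSum (p + 1) F a = binomSum p F a + binomSum p F (a + 1) := by
  unfold binomSum
  have h : ∑ t ∈ Finset.range (p + 1), (p.choose t : ℚ) * F (a + t) =
      ∑ t ∈ Finset.range (p + 1), (p.choose (t + 1) : ℚ) * F (a + (t + 1 : ℕ)) + F a := by
    have h1 := Finset.sum_range_succ' (fun t => (p.choose t : ℚ) * F (a + t)) (p + 1)
    have h2 := Finset.sum_range_succ (fun t => (p.choose t : ℚ) * F (a + t)) (p + 1)
    rw [h1] at h2
    simp only [Nat.choose_succ_self, Nat.choose_zero_right, Nat.cast_zero, zero_mul, add_zero,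
      Nat.cast_one, one_mul] at h2
    exact h2.symm
  rw [Finset.sum_range_succ', h, add_right_comm, ← Finset.sum_add_distrib]
  simp only [Nat.choose_zero_right, Nat.cast_zero, add_zero, Nat.cast_one, one_mul]
  congr 1
  refine Finset.sum_congr rfl fun t _ => ?_
  rw [Nat.choose_succ_succ]
  push_cast
  rw [show a + 1 + (t : ℤ) = a + (t + 1) by ring]
  ring

theorem binomSum_binomSum (p q : ℕ) (F : ℤ → ℚ) (a : ℤ) :
    binomSum p (binomSum q F) a = binomSum (p + q) F a := by
  induction p generalizing a with
  | zero => rw [binomSum_zero, zero_add]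
  | succ p ih => rw [binomSum_succ, ih, ih, Nat.add_right_comm, binomSum_succ]

theorem binomSum_reflect (p : ℕ) (F : ℤ → ℚ) (a : ℤ) :
    ∑ t ∈ Finset.range (p + 1), (p.choose t : ℚ) * F (a - t) = binomSum p F (a - p) := by
  rw [binomSum, ← Finset.sum_range_reflect]
  refine Finset.sum_congr rfl fun t ht => ?_
  have ht' : t ≤ p := Nat.lt_succ_iff.1 (Finset.mem_range.1 ht)
  rw [Nat.add_sub_cancel, Nat.choose_symm ht', Nat.cast_sub ht']
  congr 2
  ring

theorem binomSum_one (p : ℕ) (a : ℤ) : binomSum p (fun _ => 1) a = 2 ^ p := by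
  simp only [binomSum, mul_one]
  exact_mod_cast Nat.sum_range_choose p

theorem binomSum_intSign_add_one_sub (p : ℕ) (a : ℤ) :
    binomSum p intSign (a + 1) - binomSum p intSign a = qbinom (p + 1) (-a) := by
  induction p generalizing a with
  | zero => simpa [binomSum_zero] using intSign_add_one_sub a
  | succ p ih =>
    rw [binomSum_succ, binomSum_succ, qbinom_succ, ← ih, show -a - 1 = -(a + 1) by ring, ← ih]
    ring

theorem sum_ibinom_mul {p i m : ℕ} (h : i + (p + 1) ≤ m) (F : ℤ → ℚ) :
    ∑ k : Fin m, (ibinom p ((k : ℕ) - (i : ℕ)) : ℚ) * F (k : ℕ) = binomSum p F i := by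
  obtain ⟨e, rfl⟩ := Nat.exists_eq_add_of_le h
  rw [Fin.sum_univ_eq_sum_range
    (fun k => (ibinom p ((k : ℕ) - (i : ℕ)) : ℚ) * F (k : ℕ)) (i + (p + 1) + e),
    Finset.sum_range_add, Finset.sum_range_add, Finset.sum_eq_zero, zero_add,
    Finset.sum_eq_zero (s := Finset.range e), add_zero, binomSum]
  · refine Finset.sum_congr rfl fun t ht => ?_
    have ht' := Finset.mem_range.1 ht
    rw [ibinom, if_pos (by omega)]
    push_cast
    rw [Int.toNat_natCast, show ((i : ℤ) + t - i).toNat = t by omega]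
  · intro t _
    rw [ibinom, if_neg (by omega)]
    simp
  · intro t ht
    have ht' := Finset.mem_range.1 ht
    rw [ibinom, if_neg (by omega)]
    simp

end Binomial

section Evaluation

/-- The matrix whose maximal minors are summed in `Sminor`. -/
noncomputable def pathMatrix (x n m : ℕ) (i : Fin n) (k : Fin m) : ℚ :=
  ibinom ((x : ℤ) + (i : ℕ)) (((k : ℕ) : ℤ) - ((i : ℕ) : ℤ))

theorem Sminor_eq_minorSum (x n : ℕ) :
    (Sminor x n : ℚ) = minorSum ℚ n (2 * n + x - 1) (pathMatrix x n _) := by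
  rw [minorSum_apply, Sminor, Finset.sum_filter, Int.cast_sum]
  refine Finset.sum_congr rfl fun f _ => ?_
  split_ifs
  · rw [Int.cast_det]
    rfl
  · simp

theorem sum_pathMatrix_mul {x n m : ℕ} (i : Fin n) (h : x + 2 * (i : ℕ) + 1 ≤ m) (F : ℤ → ℚ) :
    ∑ k : Fin m, pathMatrix x n m i k * F (k : ℕ) = binomSum (x + i) F (i : ℕ) := by
  rw [← sum_ibinom_mul (m := m) (by omega)]
  simp [pathMatrix]

theorem coordSum_pathMatrix {x n m : ℕ} (i : Fin n) (h : x + 2 * (i : ℕ) + 1 ≤ m) :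
    coordSum ℚ m (pathMatrix x n m i) = 2 ^ (x + (i : ℕ)) := by
  rw [coordSum_apply, ← binomSum_one _ (i : ℕ), ← sum_pathMatrix_mul i h]
  simp

theorem orderSign_eq_intSign {m : ℕ} (k l : Fin m) :
    (orderSign k l : ℚ) = intSign ((l : ℕ) - (k : ℕ)) := by
  simp only [orderSign, intSign, Fin.lt_def, sub_pos, sub_neg, Nat.cast_lt]
  split_ifs <;> simp

theorem signForm_pathMatrix {x n m : ℕ} (i j : Fin n) (hi : x + 2 * (i : ℕ) + 1 ≤ m)
    (hj : x + 2 * (j : ℕ) + 1 ≤ m) :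
    signForm ℚ m (pathMatrix x n m i) (pathMatrix x n m j) =
      binomSum (2 * x + i + j) intSign ((j : ℕ) - 2 * (i : ℕ) - x) := by
  have h1 : ∀ k : Fin m, ∑ l : Fin m, pathMatrix x n m i k * pathMatrix x n m j l *
      (orderSign k l : ℚ) =
      pathMatrix x n m i k * binomSum (x + j) intSign ((j : ℕ) - ((k : ℕ) : ℤ)) := by
    intro k
    have h2 := sum_pathMatrix_mul j hj fun l => intSign (l - (k : ℕ))
    have h3 : binomSum (x + j) (fun l => intSign (l - (k : ℕ))) (j : ℕ) =
        binomSum (x + j) intSign ((j : ℕ) - ((k : ℕ) : ℤ)) := by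
      refine Finset.sum_congr rfl fun t _ => ?_
      congr 2
      ring_nf
    rw [← h3, ← h2, Finset.mul_sum]
    refine Finset.sum_congr rfl fun l _ => ?_
    rw [orderSign_eq_intSign, mul_assoc]
  rw [signForm_apply, Finset.sum_congr rfl fun k _ => h1 k,
    sum_pathMatrix_mul i hi fun k => binomSum (x + j) intSign ((j : ℕ) - k), binomSum]
  have h4 := binomSum_reflect (x + i) (binomSum (x + j) intSign) ((j : ℕ) - (i : ℕ))
  rw [binomSum_binomSum] at h4
  simp only [sub_sub] at h4
  simp only [h4]
  congr 1
  · ring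
  · push_cast
    ring

/-- The result of subtracting twice the preceding row from each row of `pathMatrix`. -/
noncomputable def reducedMatrix (x n m : ℕ) : Fin (n + 1) → Fin m → ℚ :=
  Fin.cons (pathMatrix x (n + 1) m 0) fun i =>
    pathMatrix x (n + 1) m i.succ - (2 : ℚ) • pathMatrix x (n + 1) m i.castSucc

theorem minorSum_reducedMatrix (x n m : ℕ) :
    minorSum ℚ (n + 1) m (reducedMatrix x n m) = minorSum ℚ (n + 1) m (pathMatrix x (n + 1) m) := by
  rw [minorSum_apply, minorSum_apply]
  refine Finset.sum_congr rfl fun f _ => Eq.symm ?_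
  refine Matrix.det_eq_of_forall_row_eq_smul_add_pred (fun _ => 2) (fun j => rfl) fun i j => ?_
  simp [reducedMatrix]

theorem signForm_reducedMatrix {x n m : ℕ} (hm : x + 2 * n + 1 ≤ m) (i j : Fin n) :
    signForm ℚ m (reducedMatrix x n m i.succ) (reducedMatrix x n m j.succ) =
      (Nat.factorial (2 * x + (i : ℕ) + (j : ℕ) + 1) : ℚ) *
        (3 * (x : ℚ) + 3 * ((i : ℕ) : ℚ) + 4) * (3 * (x : ℚ) + 3 * ((j : ℕ) : ℚ) + 4) *
        (3 * ((j : ℕ) : ℚ) - 3 * ((i : ℕ) : ℚ)) *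
        rfacInv ((x : ℤ) + 2 * (i : ℕ) - (j : ℕ) + 2) *
        rfacInv ((x : ℤ) + 2 * (j : ℕ) - (i : ℕ) + 2) := by
  have hi := i.2
  have hj := j.2
  simp only [reducedMatrix, Fin.cons_succ, map_sub, map_smul, LinearMap.sub_apply,
    LinearMap.smul_apply, smul_eq_mul]
  rw [signForm_pathMatrix _ _ (by simp; omega) (by simp; omega),
    signForm_pathMatrix _ _ (by simp; omega) (by simp; omega),
    signForm_pathMatrix _ _ (by simp; omega) (by simp; omega),
    signForm_pathMatrix _ _ (by simp; omega) (by simp; omega)]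
  simp only [Fin.val_succ, Fin.val_castSucc]
  generalize (i : ℕ) = i
  generalize (j : ℕ) = j
  obtain ⟨a, ha⟩ : ∃ a : ℤ, a = j - 2 * i - x := ⟨_, rfl⟩
  obtain ⟨P, hP⟩ : ∃ P : ℕ, P = 2 * x + i + j := ⟨_, rfl⟩
  have e1 : 2 * x + (i + 1) + (j + 1) = P + 1 + 1 := by omega
  have e2 : 2 * x + (i + 1) + j = P + 1 := by omega
  have e3 : 2 * x + i + (j + 1) = P + 1 := by omega
  have f1 : ((j + 1 : ℕ) : ℤ) - 2 * (i + 1 : ℕ) - x = a - 1 := by push_cast; omega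
  have f2 : (j : ℤ) - 2 * (i + 1 : ℕ) - x = a - 2 := by push_cast; omega
  have f3 : ((j + 1 : ℕ) : ℤ) - 2 * (i : ℕ) - x = a + 1 := by push_cast; omega
  rw [e1, e2, e3, f1, f2, f3, ← ha, ← hP]
  simp only [binomSum_succ]
  have d1 := binomSum_intSign_add_one_sub P (a - 2)
  have d2 := binomSum_intSign_add_one_sub P (a - 1)
  have d3 := binomSum_intSign_add_one_sub P a
  have d4 := binomSum_intSign_add_one_sub P (a + 1)
  obtain ⟨A, hA⟩ : ∃ A : ℤ, A = (x : ℤ) + 2 * i - j + 2 := ⟨_, rfl⟩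
  obtain ⟨B, hB⟩ : ∃ B : ℤ, B = (x : ℤ) + 2 * j - i + 2 := ⟨_, rfl⟩
  have A1 := rfacInv_sub_one A
  have A2 := rfacInv_sub_one (A - 1)
  have A3 := rfacInv_sub_one (A - 1 - 1)
  have B1 := rfacInv_sub_one B
  have B2 := rfacInv_sub_one (B - 1)
  have B3 := rfacInv_sub_one (B - 1 - 1)
  unfold qbinom at d1 d2 d3 d4
  rw [show -(a - 2) = A by omega, show ((P + 1 : ℕ) : ℤ) - A = B - 1 - 1 - 1 by omega,
    B3, B2, B1] at d1
  rw [show -(a - 1) = A - 1 by omega, show ((P + 1 : ℕ) : ℤ) - (A - 1) = B - 1 - 1 by omega,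
    B2, B1, A1] at d2
  rw [show -a = A - 1 - 1 by omega, show ((P + 1 : ℕ) : ℤ) - (A - 1 - 1) = B - 1 by omega,
    B1, A2, A1] at d3
  rw [show -(a + 1) = A - 1 - 1 - 1 by omega,
    show ((P + 1 : ℕ) : ℤ) - (A - 1 - 1 - 1) = B by omega, A3, A2, A1] at d4
  rw [← hA, ← hB]
  have hA' : (A : ℚ) = x + 2 * i - j + 2 := by rw [hA]; push_cast; ring
  have hB' : (B : ℚ) = x + 2 * j - i + 2 := by rw [hB]; push_cast; ring
  have g1 : a - 2 + 1 = a - 1 := by ring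
  have g2 : a - 1 + 1 = a := by ring
  rw [g1] at d1
  rw [g2] at d2
  simp only [g1, g2]
  push_cast at d1 d2 d3 d4
  simp only [hA', hB'] at d1 d2 d3 d4
  generalize rfacInv A = u at *
  generalize rfacInv B = w at *
  linear_combination (2 * d1) + 3 * d2 - 3 * d3 - 2 * d4

theorem coordSum_reducedMatrix_zero {x n m : ℕ} (hm : x + 2 * n + 1 ≤ m) :
    coordSum ℚ m (reducedMatrix x n m 0) = 2 ^ x := by
  have h := coordSum_pathMatrix (x := x) (m := m) (0 : Fin (n + 1)) (by simp; omega)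
  rwa [Fin.val_zero, add_zero] at h

theorem coordSum_reducedMatrix_succ {x n m : ℕ} (hm : x + 2 * n + 1 ≤ m) (i : Fin n) :
    coordSum ℚ m (reducedMatrix x n m i.succ) = 0 := by
  have hi := i.2
  rw [reducedMatrix, Fin.cons_succ, map_sub, map_smul, coordSum_pathMatrix _ (by simp; omega),
    coordSum_pathMatrix _ (by simp; omega)]
  simp [← add_assoc, pow_succ]
  ring

theorem det_upperGram_reducedMatrix {x n m : ℕ} (hn : Even n) (hm : x + 2 * n + 1 ≤ m) :
    (upperGram (reducedMatrix x n m)).det = 2 ^ (2 * x) *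
      (signGram fun i : Fin n => reducedMatrix x n m i.succ).det := by
  have h1 := eq_bordered (upperGram (reducedMatrix x n m))
  have h2 := Matrix.det_eq_zero_of_odd_skew hn.add_one (signGram_transpose (reducedMatrix x n m))
  have h3 : bordered 0 (fun j => upperGram (reducedMatrix x n m) 0 j.succ)
      (fun i => upperGram (reducedMatrix x n m) i.succ 0)
      ((upperGram (reducedMatrix x n m)).submatrix Fin.succ Fin.succ) =
      signGram (reducedMatrix x n m) := by
    ext i j
    induction i using Fin.cases <;> induction j using Fin.cases <;>
      simp [upperGram_apply, coordSum_reducedMatrix_succ hm, signGram]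
    have := signForm_swap (reducedMatrix x n m 0) (reducedMatrix x n m 0)
    linarith
  have h4 : (upperGram (reducedMatrix x n m)).submatrix Fin.succ Fin.succ =
      signGram fun i : Fin n => reducedMatrix x n m i.succ := by
    ext i j
    simp [upperGram_apply, coordSum_reducedMatrix_succ hm, signGram]
  have h5 : upperGram (reducedMatrix x n m) 0 0 = 2 ^ (2 * x) := by
    have := signForm_swap (reducedMatrix x n m 0) (reducedMatrix x n m 0)
    rw [upperGram_apply, coordSum_reducedMatrix_zero hm, mul_comm 2 x, pow_mul, pow_two]
    linarith
  rw [h1, det_bordered, h3, h2, zero_add, h4, h5]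

end Evaluation

/-- Theorem 1, item (3), odd case. -/
theorem thm1_item3_odd (x n : ℕ) (hn : Odd n) :
    ((Sminor x n : ℚ)) ^ 2 =
      2 ^ (2 * x) *
        Matrix.det (Matrix.of fun i j : Fin (n - 1) =>
          (Nat.factorial (2 * x + (i : ℕ) + (j : ℕ) + 1) : ℚ) *
            (3 * (x : ℚ) + 3 * ((i : ℕ) : ℚ) + 4) * (3 * (x : ℚ) + 3 * ((j : ℕ) : ℚ) + 4) *
            (3 * ((j : ℕ) : ℚ) - 3 * ((i : ℕ) : ℚ)) *
            rfacInv ((x : ℤ) + 2 * (i : ℕ) - (j : ℕ) + 2) *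
            rfacInv ((x : ℤ) + 2 * (j : ℕ) - (i : ℕ) + 2)) := by
  obtain ⟨r, rfl⟩ := hn
  rw [Sminor_eq_minorSum, ← minorSum_reducedMatrix, ← det_upperGram (by omega),
    det_upperGram_reducedMatrix (even_two_mul r) (by omega)]
  congr 2
  ext i j
  exact signForm_reducedMatrix (by omega) i j
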